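/- arXiv:2406.17196 — 2 statements merged into one kernel-verified Lean document; each statement's English description precedes it below -/
import Mathlib

section
/- Let A = diag(a₁, …, a_k) with |a_j| > 1 for all j and pairwise distinct diagonal entries, let Q ∈ ℝ^{k×k} be positive definite, let H = diag(h₁, …, hₙ) with hᵢ > 0, and let p ≥ 0. Suppose there exist an assignment σ : {1,…,k} → {1,…,n} and nonnegative reals π₁, …, πₙ with ∑ᵢ πᵢ = p such that for every i ∈ {1,…,n}, ∏_{j : σ(j)=i} a_j² < 1 + hᵢ²πᵢ. Then there exist a positive definite P ∈ ℝ^{k×k}, a matrix Γ ∈ ℝ^{n×k}, and a diagonal positive semidefinite Π ∈ ℝ^{n×n} with Tr(Π) ≤ p such that P = APAᵀ + Q − AΓᵀHᵀ(I + HΠHᵀ)⁻¹HΓAᵀ and ΓP⁻¹Γᵀ ⪯ Π. -/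
open Matrix

/-- The quadratic form of the Szegő kernel `1 / (1 - b j * b l)` on the nodes indexed by `s`. -/
noncomputable def szegoForm {ι : Type*} (b : ι → ℝ) (s : Finset ι) (x : ι → ℝ) : ℝ :=
  ∑ j ∈ s, ∑ l ∈ s, x j * x l / (1 - b j * b l)

lemma one_sub_mul_pos_of_abs_lt_one {u v : ℝ} (hu : |u| < 1) (hv : |v| < 1) : 0 < 1 - u * v := by
  have h : |u * v| < 1 := by
    rw [abs_mul]
    exact mul_lt_one_of_nonneg_of_lt_one_left (abs_nonneg u) hu hv.le
  linarith [le_abs_self (u * v)]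

/-- The Schur step: splitting off the node `c` leaves the Szegő form of the remaining nodes,
evaluated at the coefficients weighted by the Blaschke factor of `c`. -/
lemma szegoForm_insert {ι : Type*} [DecidableEq ι] {b : ι → ℝ} (hb : ∀ j, |b j| < 1)
    {s : Finset ι} {c : ι} (hc : c ∉ s) (x : ι → ℝ) :
    szegoForm b (insert c s) x =
      (1 - b c ^ 2) * (∑ j ∈ insert c s, x j / (1 - b c * b j)) ^ 2 +
        szegoForm b s (fun j => x j * (b j - b c) / (1 - b c * b j)) := by
  set y : ι → ℝ := fun j => x j * (b j - b c) / (1 - b c * b j) with hy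
  have hyc : y c = 0 := by simp [hy]
  have hs : szegoForm b s y = szegoForm b (insert c s) y := by
    simp [szegoForm, Finset.sum_insert hc, hyc]
  rw [hs, sq (∑ j ∈ insert c s, x j / (1 - b c * b j)), Finset.sum_mul_sum, Finset.mul_sum]
  simp only [szegoForm]
  rw [← Finset.sum_add_distrib]
  refine Finset.sum_congr rfl fun j _ => ?_
  rw [Finset.mul_sum, ← Finset.sum_add_distrib]
  refine Finset.sum_congr rfl fun l _ => ?_
  have h1 := (one_sub_mul_pos_of_abs_lt_one (hb c) (hb j)).ne'
  have h2 := (one_sub_mul_pos_of_abs_lt_one (hb c) (hb l)).ne'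
  have h3 := (one_sub_mul_pos_of_abs_lt_one (hb j) (hb l)).ne'
  simp only [hy]
  rw [div_mul_div_comm, div_mul_div_comm, mul_div_assoc', div_div, div_add_div _ _
    (mul_ne_zero h1 h2) (mul_ne_zero (mul_ne_zero h1 h2) h3), div_eq_div_iff h3
    (mul_ne_zero (mul_ne_zero h1 h2) (mul_ne_zero (mul_ne_zero h1 h2) h3))]
  ring

lemma szegoForm_bounds {ι : Type*} [DecidableEq ι] {b : ι → ℝ} (hb : ∀ j, |b j| < 1)
    (hinj : Function.Injective b) (s : Finset ι) (x : ι → ℝ) :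
    0 ≤ szegoForm b s x ∧ (szegoForm b s x = 0 → ∀ j ∈ s, x j = 0) ∧
      (∑ j ∈ s, x j) ^ 2 ≤ (1 - ∏ j ∈ s, b j ^ 2) * szegoForm b s x := by
  induction s using Finset.induction_on generalizing x with
  | empty => simp [szegoForm]
  | insert c s hc ih =>
    set y : ι → ℝ := fun j => x j * (b j - b c) / (1 - b c * b j) with hy
    set F := ∑ j ∈ insert c s, x j / (1 - b c * b j) with hF
    obtain ⟨h0, hz, hle⟩ := ih y
    have hq : szegoForm b (insert c s) x = (1 - b c ^ 2) * F ^ 2 + szegoForm b s y :=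
      szegoForm_insert hb hc x
    have hbc : 0 < 1 - b c ^ 2 := by
      rw [sq]
      exact one_sub_mul_pos_of_abs_lt_one (hb c) (hb c)
    have hsum : ∑ j ∈ insert c s, x j = (1 - b c ^ 2) * F - b c * ∑ j ∈ s, y j := by
      have hys : ∑ j ∈ s, y j = ∑ j ∈ insert c s, y j := by
        simp [Finset.sum_insert hc, hy]
      rw [hys, hF, Finset.mul_sum, Finset.mul_sum, ← Finset.sum_sub_distrib]
      refine Finset.sum_congr rfl fun j _ => ?_
      have h1 := (one_sub_mul_pos_of_abs_lt_one (hb c) (hb j)).ne'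
      simp only [hy]
      field_simp
      ring
    have hF2 : 0 ≤ (1 - b c ^ 2) * F ^ 2 := by positivity
    refine ⟨by rw [hq]; linarith, fun hzero => ?_, ?_⟩
    · have hy0 : szegoForm b s y = 0 := by linarith
      have hxs : ∀ j ∈ s, x j = 0 := fun j hj => by
        have h1 := (one_sub_mul_pos_of_abs_lt_one (hb c) (hb j)).ne'
        have h2 : b j - b c ≠ 0 :=
          sub_ne_zero.mpr fun e => hc (hinj e ▸ hj)
        have h3 := hz hy0 j hj
        simp only [hy] at h3
        simpa [h1, h2] using h3
      have hFz : F = 0 := by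
        have h4 : (1 - b c ^ 2) * F ^ 2 = 0 := by linarith
        simpa [hbc.ne'] using h4
      have hxc : x c = 0 := by
        have h5 : F = x c / (1 - b c * b c) := by
          rw [hF, Finset.sum_insert hc, Finset.sum_eq_zero, add_zero]
          intro j hj
          simp [hxs j hj]
        rw [h5, div_eq_zero_iff] at hFz
        exact hFz.resolve_right (one_sub_mul_pos_of_abs_lt_one (hb c) (hb c)).ne'
      intro j hj
      rcases Finset.mem_insert.mp hj with rfl | hj
      · exact hxc
      · exact hxs j hj
    · rw [hq, hsum, Finset.prod_insert hc]
      set G := ∑ j ∈ s, y j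
      set r := ∏ j ∈ s, b j ^ 2
      set q := szegoForm b s y
      set β := b c
      set e := 1 - β ^ 2 with he
      have hkey : (e * F - β * G) ^ 2 ≤ (e + β ^ 2 * (1 - r)) * (e * F ^ 2 + q) := by
        by_cases hr : 0 < 1 - r
        · have hG : G ^ 2 / (1 - r) ≤ q := by
            rw [div_le_iff₀ hr]; linarith
          have h6 : (e * F - β * G) ^ 2 ≤
              (e + β ^ 2 * (1 - r)) * (e * F ^ 2 + G ^ 2 / (1 - r)) := by
            have : (e + β ^ 2 * (1 - r)) * (e * F ^ 2 + G ^ 2 / (1 - r)) - (e * F - β * G) ^ 2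
                = e / (1 - r) * (β * (1 - r) * F + G) ^ 2 := by
              field_simp
              ring
            have : 0 ≤ e / (1 - r) * (β * (1 - r) * F + G) ^ 2 := by positivity
            linarith
          refine h6.trans ?_
          have : 0 ≤ e + β ^ 2 * (1 - r) := by positivity
          gcongr
        · have hr1 : r ≤ 1 := Finset.prod_le_one (fun j _ => sq_nonneg _) fun j _ => by
            rw [sq_le_one_iff_abs_le_one]; exact (hb j).le
          have hr2 : 1 - r = 0 := by linarith
          rw [hr2, zero_mul] at hle
          have hG0 : G = 0 := by nlinarith
          rw [hG0, hr2]
          nlinarith [mul_nonneg hbc.le h0]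
      refine hkey.trans_eq ?_
      rw [he]
      ring

/-- Positive definiteness survives small symmetric perturbations. -/
lemma Matrix.PosDef.exists_pos_sub_smul {ι : Type*} [Fintype ι] {R N : Matrix ι ι ℝ}
    (hR : R.PosDef) (hN : N.IsHermitian) : ∃ ε : ℝ, 0 < ε ∧ (R - ε • N).PosDef := by
  have hform : ∀ (ε : ℝ) (x : ι → ℝ),
      x ⬝ᵥ ((R - ε • N) *ᵥ x) = x ⬝ᵥ (R *ᵥ x) - ε * (x ⬝ᵥ (N *ᵥ x)) := fun ε x => by
    simp [sub_mulVec, smul_mulVec, dotProduct_sub]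
  have hherm : ∀ ε : ℝ, (R - ε • N).IsHermitian := fun ε => by
    refine hR.isHermitian.sub ?_
    rw [IsHermitian, conjTranspose_smul, hN.eq, star_trivial]
  have hcont : ∀ M : Matrix ι ι ℝ, Continuous fun x : ι → ℝ => x ⬝ᵥ (M *ᵥ x) := fun M => by
    fun_prop
  rcases (Metric.sphere (0 : ι → ℝ) 1).eq_empty_or_nonempty with hemp | hne
  · refine ⟨1, one_pos, .of_dotProduct_mulVec_pos (hherm 1) fun x hx => ?_⟩
    have : (‖x‖⁻¹ • x) ∈ Metric.sphere (0 : ι → ℝ) 1 := by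
      simp [norm_smul, norm_ne_zero_iff.mpr hx]
    simp [hemp] at this
  · have hcomp : IsCompact (Metric.sphere (0 : ι → ℝ) 1) := isCompact_sphere _ _
    obtain ⟨u, hu, humin⟩ := hcomp.exists_isMinOn hne (hcont R).continuousOn
    obtain ⟨v, hv, hvmax⟩ := hcomp.exists_isMaxOn hne (hcont N).continuousOn
    have hu0 : u ≠ 0 := by
      rintro rfl
      simp at hu
    set m := u ⬝ᵥ (R *ᵥ u)
    set K := v ⬝ᵥ (N *ᵥ v)
    have hm : 0 < m := by simpa using hR.dotProduct_mulVec_pos hu0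
    have hK : 0 < |K| + 1 := by positivity
    refine ⟨m / (2 * (|K| + 1)), by positivity,
      .of_dotProduct_mulVec_pos (hherm _) fun x hx => ?_⟩
    have hx0 : 0 < ‖x‖ := norm_pos_iff.mpr hx
    set z := ‖x‖⁻¹ • x with hz
    have hzs : z ∈ Metric.sphere (0 : ι → ℝ) 1 := by
      simp [hz, norm_smul, hx0.ne']
    have hxz : x = ‖x‖ • z := by simp [hz, smul_smul, hx0.ne']
    have h1 : m ≤ z ⬝ᵥ (R *ᵥ z) := humin hzs
    have h2 : z ⬝ᵥ (N *ᵥ z) ≤ K := hvmax hzs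
    have h3 : m / (2 * (|K| + 1)) * (z ⬝ᵥ (N *ᵥ z)) < m := by
      calc m / (2 * (|K| + 1)) * (z ⬝ᵥ (N *ᵥ z))
          ≤ m / (2 * (|K| + 1)) * (|K| + 1) := by
            gcongr
            linarith [le_abs_self K]
        _ = m / 2 := by field_simp
        _ < m := by linarith
    have h4 : 0 < z ⬝ᵥ ((R - (m / (2 * (|K| + 1))) • N) *ᵥ z) := by
      rw [hform]
      linarith
    rw [star_trivial, hxz, mulVec_smul, dotProduct_smul, smul_dotProduct, smul_eq_mul, smul_eq_mul]
    positivity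

lemma szegoForm_strict_bound {ι : Type*} [DecidableEq ι] {b : ι → ℝ} (hb : ∀ j, |b j| < 1)
    (hinj : Function.Injective b) (s : Finset ι) (x : ι → ℝ) {κ : ℝ}
    (hκ : 1 - ∏ j ∈ s, b j ^ 2 < κ) (hx : ∃ j ∈ s, x j ≠ 0) :
    (∑ j ∈ s, x j) ^ 2 < κ * szegoForm b s x := by
  obtain ⟨h0, hz, hle⟩ := szegoForm_bounds hb hinj s x
  obtain ⟨j, hj, hxj⟩ := hx
  have hpos : 0 < szegoForm b s x := h0.lt_of_ne fun e => hxj (hz e.symm j hj)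
  nlinarith

/-- The block-diagonal matrix, with blocks the fibres of `σ`, obtained from the scaled Szegő
kernel by subtracting a multiple of the all-ones matrix in each block. -/
lemma posDef_szego_blocks {k n : ℕ} {b : Fin k → ℝ} (hb : ∀ j, |b j| < 1)
    (hinj : Function.Injective b) (σ : Fin k → Fin n) (c w : Fin n → ℝ) (hw : ∀ i, 0 < w i)
    (hcw : ∀ i, 1 - ∏ j ∈ Finset.univ.filter (fun j => σ j = i), b j ^ 2 < c i * w i) :
    (Matrix.of fun j l : Fin k =>
      if σ j = σ l then c (σ j) / (1 - b j * b l) - (w (σ j))⁻¹ else 0).PosDef := by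
  refine .of_dotProduct_mulVec_pos ?_ fun x hx => ?_
  · ext j l
    simp only [conjTranspose_apply, of_apply, star_trivial]
    by_cases hjl : σ j = σ l
    · simp [hjl, mul_comm]
    · simp [hjl, Ne.symm hjl]
  · set S : Fin n → Finset (Fin k) := fun i => Finset.univ.filter (fun j => σ j = i) with hS
    have hform : star x ⬝ᵥ ((Matrix.of fun j l : Fin k =>
        if σ j = σ l then c (σ j) / (1 - b j * b l) - (w (σ j))⁻¹ else 0) *ᵥ x) =
        ∑ i, (w i)⁻¹ * (c i * w i * szegoForm b (S i) x - (∑ j ∈ S i, x j) ^ 2) := by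
      simp only [dotProduct, mulVec, star_trivial, of_apply]
      rw [← Finset.sum_fiberwise Finset.univ σ]
      refine Finset.sum_congr rfl fun i _ => ?_
      have hwi := (hw i).ne'
      rw [sq, Finset.sum_mul_sum, szegoForm, Finset.mul_sum, ← Finset.sum_sub_distrib,
        Finset.mul_sum]
      refine Finset.sum_congr rfl fun j hj => ?_
      have hji : σ j = i := (Finset.mem_filter.mp hj).2
      rw [Finset.mul_sum, Finset.mul_sum, ← Finset.sum_sub_distrib, Finset.mul_sum, hS,
        Finset.sum_filter]
      refine Finset.sum_congr rfl fun l _ => ?_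
      rw [hji]
      by_cases hl : σ l = i
      · rw [if_pos hl.symm, if_pos hl]
        field_simp
      · rw [if_neg (Ne.symm hl), if_neg hl]
        ring
    rw [hform]
    have hterm : ∀ i, (∃ j ∈ S i, x j ≠ 0) →
        0 < (w i)⁻¹ * (c i * w i * szegoForm b (S i) x - (∑ j ∈ S i, x j) ^ 2) := fun i hi =>
      mul_pos (inv_pos.mpr (hw i))
        (sub_pos.mpr (szegoForm_strict_bound hb hinj (S i) x (hcw i) hi))
    refine Finset.sum_pos' (fun i _ => ?_) ?_
    · by_cases hi : ∃ j ∈ S i, x j ≠ 0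
      · exact (hterm i hi).le
      · push Not at hi
        rw [Finset.sum_eq_zero hi, szegoForm,
          Finset.sum_eq_zero fun j hj => Finset.sum_eq_zero fun l _ => by simp [hi j hj]]
        simp
    · obtain ⟨j, hj⟩ := Function.ne_iff.mp hx
      exact ⟨σ j, Finset.mem_univ _, hterm _ ⟨j, by simp [hS], hj⟩⟩

lemma posSemidef_schur_swap {ι κ : Type*} [Fintype ι] [Fintype κ] [DecidableEq ι]
    [DecidableEq κ] {P : Matrix ι ι ℝ} {D : Matrix κ κ ℝ} (hP : P.PosDef) (hD : D.PosDef)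
    (G : Matrix κ ι ℝ) (h : (P - Gᵀ * D⁻¹ * G).PosSemidef) :
    (D - G * P⁻¹ * Gᵀ).PosSemidef := by
  have := hP.isUnit.invertible
  have := hD.isUnit.invertible
  have h1 := (hD.fromBlocks₂₂ P Gᵀ).mpr (by simpa [conjTranspose_eq_transpose_of_trivial] using h)
  simpa [conjTranspose_eq_transpose_of_trivial] using (hP.fromBlocks₁₁ Gᵀ D).mp h1

/-- Sufficiency for MIMO channels: if the unstable modes of `A = diag a` (with `|aⱼ| > 1`,
distinct) can be assigned via `σ` to sub-channels of `H = diag h` with a power allocation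
`w` summing to `p` so that `∏_{j : σ j = i} aⱼ² < 1 + hᵢ² wᵢ` for every sub-channel `i`,
then there is a power-feasible stabilizing DARE solution: `P ≻ 0`, an encoder `Γ`, and a
diagonal PSD `Π = diag d` with `Tr ≤ p` satisfying the DARE and `Γ P⁻¹ Γᵀ ⪯ diag d`. -/
theorem stmt4 {k n : ℕ} (a : Fin k → ℝ) (ha : ∀ j, 1 < |a j|)
    (hdist : Function.Injective a)
    (Q : Matrix (Fin k) (Fin k) ℝ) (hQ : Q.PosDef)
    (h : Fin n → ℝ) (hh : ∀ i, 0 < h i) (p : ℝ) (hp : 0 ≤ p)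
    (σ : Fin k → Fin n) (w : Fin n → ℝ) (hw : ∀ i, 0 ≤ w i) (hsum : ∑ i, w i = p)
    (hcap : ∀ i, (∏ j ∈ Finset.univ.filter (fun j => σ j = i), (a j) ^ 2)
                  < 1 + (h i) ^ 2 * w i) :
    ∃ (P : Matrix (Fin k) (Fin k) ℝ) (Γ : Matrix (Fin n) (Fin k) ℝ) (d : Fin n → ℝ),
      P.PosDef ∧ (diagonal d).PosSemidef ∧ (diagonal d).trace ≤ p ∧
      P = diagonal a * P * (diagonal a)ᵀ + Q
        - diagonal a * Γᵀ * (diagonal h)ᵀ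
            * (1 + diagonal h * diagonal d * (diagonal h)ᵀ)⁻¹
            * diagonal h * Γ * (diagonal a)ᵀ ∧
      (diagonal d - Γ * P⁻¹ * Γᵀ).PosSemidef := by
  have hab : ∀ j l, 0 < |a j * a l| - 1 := fun j l => by
    rw [abs_mul]
    nlinarith [ha j, ha l]
  have ha0 : ∀ j, a j ≠ 0 := fun j e => by
    have := ha j
    norm_num [e] at this
  have hab1 : ∀ j l, a j * a l - 1 ≠ 0 := fun j l e => by
    have := hab j l
    rw [sub_eq_zero.mp e] at this
    norm_num at this
  have hw0 : ∀ i, 0 < w i := fun i => by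
    have h1 : (1 : ℝ) ≤ ∏ j ∈ Finset.univ.filter (fun j => σ j = i), a j ^ 2 :=
      Finset.prod_induction _ (1 ≤ ·) (fun _ _ => one_le_mul_of_one_le_of_one_le) le_rfl
        fun j _ => (one_le_sq_iff_one_le_abs _).mpr (ha j).le
    have h2 := hcap i
    refine (hw i).lt_of_ne fun e => ?_
    rw [← e] at h2
    linarith
  have hden : ∀ i, 0 < 1 + h i ^ 2 * w i := fun i => by
    have := hw i
    positivity
  set c : Fin n → ℝ := fun i => h i ^ 2 / (1 + h i ^ 2 * w i) with hc
  have hcw : ∀ i, 1 - ∏ j ∈ Finset.univ.filter (fun j => σ j = i), (a j)⁻¹ ^ 2 < c i * w i := by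
    intro i
    have h1 : 0 < ∏ j ∈ Finset.univ.filter (fun j => σ j = i), a j ^ 2 :=
      Finset.prod_pos fun j _ => by have := ha0 j; positivity
    simp only [inv_pow, Finset.prod_inv_distrib]
    have h2 := inv_strictAnti₀ h1 (hcap i)
    have h3 : c i * w i = 1 - (1 + h i ^ 2 * w i)⁻¹ := by
      have := (hden i).ne'
      simp only [hc]
      field_simp
      ring
    linarith
  have hR := posDef_szego_blocks (b := fun j => (a j)⁻¹)
    (fun j => by rw [abs_inv]; exact inv_lt_one_of_one_lt₀ (ha j))
    (inv_injective.comp hdist) σ c w hw0 hcw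
  set R := Matrix.of fun j l : Fin k =>
    if σ j = σ l then c (σ j) / (1 - (a j)⁻¹ * (a l)⁻¹) - (w (σ j))⁻¹ else 0 with hRdef
  set N : Matrix (Fin k) (Fin k) ℝ := Matrix.of fun j l => Q j l / (a j * a l - 1) with hN
  have hQs : ∀ j l, Q j l = Q l j := fun j l => by
    simpa using (hQ.isHermitian.apply j l).symm
  have hNh : N.IsHermitian := by
    ext j l
    simp [hN, hQs l j, mul_comm]
  obtain ⟨ε, hε, hpd⟩ := hR.exists_pos_sub_smul hNh
  set t := √(ε⁻¹) with ht
  have ht2 : t * t = ε⁻¹ := Real.mul_self_sqrt (by positivity)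
  set Γ : Matrix (Fin n) (Fin k) ℝ := Matrix.of fun i j => if σ j = i then t else 0 with hΓ
  have hΓd : ∀ (v : Fin n → ℝ) (j l : Fin k),
      (Γᵀ * diagonal v * Γ) j l = if σ j = σ l then ε⁻¹ * v (σ j) else 0 := fun v j l => by
    rw [mul_apply]
    simp only [mul_diagonal, transpose_apply, hΓ, of_apply, ite_mul, zero_mul,
      Finset.sum_ite_eq, Finset.mem_univ, if_true, mul_ite, mul_zero]
    by_cases hjl : σ j = σ l
    · rw [if_pos hjl, if_pos hjl, hjl, ← ht2]
      ring
    · rw [if_neg hjl, if_neg hjl]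
  have hDinv : ∀ v : Fin n → ℝ, (∀ i, 0 < v i) → (diagonal v)⁻¹ = diagonal fun i => (v i)⁻¹ :=
    fun v hv => inv_eq_right_inv <| by
      rw [diagonal_mul_diagonal, ← diagonal_one]
      exact congrArg diagonal (funext fun i => mul_inv_cancel₀ (hv i).ne')
  set P : Matrix (Fin k) (Fin k) ℝ := Γᵀ * (diagonal w)⁻¹ * Γ + ε⁻¹ • (R - ε • N) with hP
  have hWpd : (diagonal w).PosDef := .diagonal hw0
  have hscaled : (ε⁻¹ • (R - ε • N)).PosDef := hpd.smul (inv_pos.mpr hε)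
  have hPpd : P.PosDef := by
    refine PosDef.posSemidef_add ?_ hscaled
    simpa [conjTranspose_eq_transpose_of_trivial] using
      hWpd.inv.posSemidef.conjTranspose_mul_mul_same Γ
  have hPapply : ∀ j l, P j l =
      ((if σ j = σ l then ε⁻¹ * c (σ j) else 0) * (a j * a l) - Q j l) / (a j * a l - 1) := by
    intro j l
    have h1 := hab1 j l
    have h2 : (1 : ℝ) - (a j)⁻¹ * (a l)⁻¹ = (a j * a l - 1) / (a j * a l) := by
      have := ha0 j
      have := ha0 l
      field_simp
    have h3 := ha0 j
    have h4 := ha0 l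
    rw [hP, hDinv w hw0, Matrix.add_apply, hΓd, Matrix.smul_apply, Matrix.sub_apply,
      Matrix.smul_apply, hRdef, hN, of_apply, of_apply, h2, smul_eq_mul, smul_eq_mul]
    by_cases hjl : σ j = σ l
    · simp only [if_pos hjl]
      field_simp
      ring
    · simp only [if_neg hjl]
      field_simp
      ring
  refine ⟨P, Γ, w, hPpd, hWpd.posSemidef, ?_, ?_, ?_⟩
  · rw [trace_diagonal, hsum]
  · have hch : diagonal a * Γᵀ * (diagonal h)ᵀ * (1 + diagonal h * diagonal w * (diagonal h)ᵀ)⁻¹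
        * diagonal h * Γ * (diagonal a)ᵀ =
        diagonal a * (Γᵀ * diagonal c * Γ) * diagonal a := by
      have h1 : (1 + diagonal h * diagonal w * (diagonal h)ᵀ : Matrix (Fin n) (Fin n) ℝ) =
          diagonal fun i => 1 + h i ^ 2 * w i := by
        rw [diagonal_transpose, diagonal_mul_diagonal, diagonal_mul_diagonal, ← diagonal_one,
          diagonal_add]
        exact congrArg diagonal (funext fun i => by ring)
      have h2 : diagonal h * (diagonal fun i => (1 + h i ^ 2 * w i)⁻¹) * diagonal h =
          diagonal c := by
        rw [diagonal_mul_diagonal, diagonal_mul_diagonal]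
        exact congrArg diagonal (funext fun i => by simp only [hc]; ring)
      rw [h1, hDinv _ hden, diagonal_transpose, diagonal_transpose, ← h2]
      simp only [Matrix.mul_assoc]
    rw [hch, diagonal_transpose]
    ext j l
    rw [Matrix.sub_apply, Matrix.add_apply, mul_diagonal, diagonal_mul, mul_diagonal,
      diagonal_mul, hΓd, hPapply]
    have h1 := hab1 j l
    field_simp
    ring
  · refine posSemidef_schur_swap hPpd hWpd Γ ?_
    rw [hP, add_sub_cancel_left]
    exact hscaled.posSemidef
end

section
/- Let A = diag(a₁, …, a_k) with |a_j| > 1 for all j and pairwise distinct diagonal entries, let Q ∈ ℝ^{k×k} be positive definite, let h ≠ 0 be a real scalar, and let p > 0. Then the following are equivalent: (i) there exist a positive definite P ∈ ℝ^{k×k}, a row vector Γ ∈ ℝ^{1×k}, and a real π with 0 ≤ π ≤ p such that P = APAᵀ + Q − (h²/(1 + h²π)) AΓᵀΓAᵀ and ΓP⁻¹Γᵀ ≤ π; (ii) ∏_{j=1}^{k} a_j² < 1 + h²p. -/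
open Matrix

section

variable {n : Type*} [Fintype n]

theorem Matrix.dotProduct_vecMulVec_self_mulVec (u z : n → ℝ) :
    z ⬝ᵥ (vecMulVec u u *ᵥ z) = (u ⬝ᵥ z) ^ 2 := by
  rw [vecMulVec_mulVec, dotProduct_smul, dotProduct_comm z u]
  simp [sq]

theorem Matrix.PosDef.eventually_sub_smul {S R : Matrix n n ℝ} (hS : S.PosDef)
    (hR : R.IsHermitian) : ∀ᶠ s : ℝ in nhds 0, (S - s • R).PosDef := by
  have hcont : Continuous fun q : ℝ × (n → ℝ) ↦ q.2 ⬝ᵥ ((S - q.1 • R) *ᵥ q.2) := by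
    fun_prop
  have hev : ∀ᶠ s : ℝ in nhds 0, ∀ z ∈ Metric.sphere (0 : n → ℝ) 1,
      0 < z ⬝ᵥ ((S - s • R) *ᵥ z) := by
    refine (isCompact_sphere _ _).eventually_forall_of_forall_eventually fun z hz ↦ ?_
    refine hcont.continuousAt.eventually_const_lt ?_
    have hz0 : z ≠ 0 := by
      rintro rfl
      simp at hz
    simpa using hS.dotProduct_mulVec_pos hz0
  filter_upwards [hev] with s hs
  refine .of_dotProduct_mulVec_pos (hS.1.sub ?_) fun z hz ↦ ?_
  · ext i j
    simpa using Or.inl (hR.apply i j)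
  have hnz : 0 < ‖z‖ := norm_pos_iff.mpr hz
  have h := hs (‖z‖⁻¹ • z) (by simp [norm_smul, hnz.ne'])
  rw [mulVec_smul, smul_dotProduct, dotProduct_smul, smul_eq_mul, smul_eq_mul] at h
  rw [star_trivial]
  have hinv := inv_pos.mpr hnz
  exact pos_of_mul_pos_right (pos_of_mul_pos_right h hinv.le) hinv.le

variable [DecidableEq n]

open scoped MatrixOrder in
theorem Matrix.PosDef.exists_isUnit_conjTranspose_mul_self {Q : Matrix n n ℝ} (hQ : Q.PosDef) :
    ∃ B : Matrix n n ℝ, IsUnit B ∧ Q = Bᴴ * B := by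
  obtain ⟨B, hB, h⟩ := CStarAlgebra.isStrictlyPositive_iff_eq_star_mul_self.mp
    hQ.isStrictlyPositive
  exact ⟨B, hB, h⟩

theorem Matrix.IsHermitian.det_one_add_eq_prod {T : Matrix n n ℝ} (hT : T.IsHermitian) :
    (1 + T).det = ∏ i, (1 + hT.eigenvalues i) := by
  have h : 1 + T = Unitary.conjStarAlgAut ℝ _ hT.eigenvectorUnitary
      (1 + diagonal hT.eigenvalues) := by
    rw [map_add, map_one]
    congr 1
    exact hT.spectral_theorem
  rw [h, Unitary.conjStarAlgAut_apply, det_mul_right_comm, ← Unitary.coe_star,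
    Unitary.coe_mul_star_self, one_mul, ← diagonal_one, diagonal_add, det_diagonal]

theorem Matrix.PosSemidef.det_lt_det_add_posDef [Nonempty n] {N Q : Matrix n n ℝ}
    (hN : N.PosSemidef) (hQ : Q.PosDef) : N.det < (N + Q).det := by
  obtain ⟨B, hB, rfl⟩ := hQ.exists_isUnit_conjTranspose_mul_self
  have hBd : IsUnit B.det := (isUnit_iff_isUnit_det B).mp hB
  set T := (B⁻¹)ᴴ * N * B⁻¹ with hTdef
  have hT : T.PosSemidef := hN.conjTranspose_mul_mul_same _
  have hBB : B⁻¹ * B = 1 := nonsing_inv_mul B hBd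
  have hBB' : Bᴴ * (B⁻¹)ᴴ = 1 := by rw [← conjTranspose_mul, hBB, conjTranspose_one]
  have hNT : N = Bᴴ * T * B := by
    calc N = (Bᴴ * (B⁻¹)ᴴ) * N * (B⁻¹ * B) := by rw [hBB, hBB', one_mul, mul_one]
      _ = Bᴴ * T * B := by simp only [hTdef, mul_assoc]
  have hNQ : N + Bᴴ * B = Bᴴ * (1 + T) * B := by
    rw [mul_add, add_mul, mul_one, ← hNT, add_comm]
  have hlt : T.det < (1 + T).det := by
    rw [hT.1.det_one_add_eq_prod, hT.1.det_eq_prod_eigenvalues]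
    have h0 := hT.eigenvalues_nonneg
    by_cases hz : ∃ i, hT.1.eigenvalues i = 0
    · obtain ⟨i, hi⟩ := hz
      have : ∏ i, ((hT.1.eigenvalues i : ℝ)) = 0 := Finset.prod_eq_zero (Finset.mem_univ i) hi
      simp only [RCLike.ofReal_real_eq_id, id_eq, this]
      exact Finset.prod_pos fun i _ ↦ by linarith [h0 i]
    · push Not at hz
      exact Finset.prod_lt_prod_of_nonempty (fun i _ ↦ lt_of_le_of_ne (h0 i) (hz i).symm)
        (fun i _ ↦ by simp) Finset.univ_nonempty
  have hpos : 0 < B.det * B.det := mul_self_pos.mpr hBd.ne_zero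
  calc N.det = B.det * B.det * T.det := by
        rw [hNT, det_mul, det_mul, det_conjTranspose, star_trivial]
        ring
    _ < B.det * B.det * (1 + T).det := by gcongr
    _ = (N + Bᴴ * B).det := by
        rw [hNQ, det_mul, det_mul, det_conjTranspose, star_trivial]
        ring

theorem Matrix.PosDef.sub_smul_vecMulVec_posSemidef {P : Matrix n n ℝ} (hP : P.PosDef)
    (u : n → ℝ) {c : ℝ} (hc : 0 ≤ c) (hcu : c * (u ⬝ᵥ P⁻¹ *ᵥ u) ≤ 1) :
    (P - c • vecMulVec u u).PosSemidef := by
  refine .of_dotProduct_mulVec_nonneg (hP.1.sub ?_) fun z ↦ ?_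
  · ext i j
    simp [vecMulVec_apply, mul_comm]
  have hPd : IsUnit P.det := (isUnit_iff_isUnit_det P).mp hP.isUnit
  have hPT : Pᵀ = P := by simpa only [conjTranspose_eq_transpose_of_trivial] using hP.1.eq
  have h := hP.posSemidef.dotProduct_mulVec_nonneg (z - (c * (u ⬝ᵥ z)) • (P⁻¹ *ᵥ u))
  have hPu : P *ᵥ (P⁻¹ *ᵥ u) = u := by rw [mulVec_mulVec, mul_nonsing_inv P hPd, one_mulVec]
  have hsymm : (P⁻¹ *ᵥ u) ⬝ᵥ (P *ᵥ z) = u ⬝ᵥ z := by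
    rw [dotProduct_mulVec, ← mulVec_transpose, hPT, hPu]
  simp only [star_trivial, mulVec_sub, mulVec_smul, hPu, sub_dotProduct, dotProduct_sub,
    smul_dotProduct, dotProduct_smul, hsymm, smul_eq_mul] at h
  rw [dotProduct_comm z u, dotProduct_comm (P⁻¹ *ᵥ u) u] at h
  rw [star_trivial, sub_mulVec, dotProduct_sub, smul_mulVec, dotProduct_smul,
    dotProduct_vecMulVec_self_mulVec, smul_eq_mul]
  nlinarith [mul_nonneg (mul_nonneg hc (sq_nonneg (u ⬝ᵥ z))) (sub_nonneg.mpr hcu)]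

theorem Matrix.det_add_smul_vecMulVec {P : Matrix n n ℝ} (hP : IsUnit P.det) (u : n → ℝ) (c : ℝ) :
    (P + c • vecMulVec u u).det = P.det * (1 + c * (u ⬝ᵥ P⁻¹ *ᵥ u)) := by
  have h := det_add_replicateCol_mul_replicateRow (ι := Unit) hP (c • u) u
  rw [← vecMulVec_eq, smul_vecMulVec] at h
  rw [h, det_unique (1 + _), Matrix.mul_assoc, ← replicateCol_mulVec, Matrix.add_apply,
    one_apply_eq, replicateRow_mul_replicateCol_apply, mulVec_smul, dotProduct_smul, smul_eq_mul]

end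

theorem hasSum_sq_sum_mul_pow {k : ℕ} {b : Fin k → ℝ} (hb : ∀ i, |b i| < 1) (z : Fin k → ℝ) :
    HasSum (fun m : ℕ ↦ (∑ i, z i * b i ^ m) ^ 2)
      (z ⬝ᵥ (Matrix.of fun i j ↦ (1 - b i * b j)⁻¹) *ᵥ z) := by
  have h : ∀ i j, HasSum (fun m : ℕ ↦ z i * z j * (b i * b j) ^ m)
      (z i * z j * (1 - b i * b j)⁻¹) := fun i j ↦ by
    refine (hasSum_geometric_of_abs_lt_one ?_).mul_left _
    rw [abs_mul]
    exact mul_lt_one_of_nonneg_of_lt_one_left (abs_nonneg _) (hb i) (hb j).le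
  convert hasSum_sum (s := Finset.univ) fun i _ ↦ hasSum_sum (s := Finset.univ) fun j _ ↦ h i j
    using 1
  · ext m
    rw [sq, Finset.sum_mul_sum]
    refine Finset.sum_congr rfl fun i _ ↦ Finset.sum_congr rfl fun j _ ↦ ?_
    rw [mul_pow]
    ring
  · simp only [dotProduct, mulVec, of_apply, Finset.mul_sum]
    refine Finset.sum_congr rfl fun i _ ↦ Finset.sum_congr rfl fun j _ ↦ ?_
    ring

theorem posDef_one_sub_mul_inv {k : ℕ} {b : Fin k → ℝ} (hb : ∀ i, |b i| < 1)
    (hinj : Function.Injective b) :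
    (Matrix.of fun i j ↦ (1 - b i * b j)⁻¹ : Matrix (Fin k) (Fin k) ℝ).PosDef := by
  refine .of_dotProduct_mulVec_pos ?_ fun z hz ↦ ?_
  · ext i j
    simp [mul_comm]
  have h := hasSum_sq_sum_mul_pow hb z
  rw [star_trivial]
  refine lt_of_le_of_ne (h.nonneg fun _ ↦ sq_nonneg _) fun h0 ↦ hz ?_
  rw [← h0, hasSum_zero_iff_of_nonneg fun _ ↦ sq_nonneg _] at h
  exact eq_zero_of_forall_pow_sum_mul_pow_eq_zero hinj fun i ↦ by
    simpa using congrFun h (i : ℕ)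

theorem one_dotProduct_inv_mulVec_one {k : ℕ} {b : Fin k → ℝ} (hb : ∀ i, |b i| < 1)
    (hinj : Function.Injective b) :
    (1 : Fin k → ℝ) ⬝ᵥ
      (Matrix.of fun i j ↦ (1 - b i * b j)⁻¹ : Matrix (Fin k) (Fin k) ℝ)⁻¹ *ᵥ 1
      = 1 - ∏ i, b i ^ 2 := by
  have hC := posDef_one_sub_mul_inv hb hinj
  set C : Matrix (Fin k) (Fin k) ℝ := Matrix.of fun i j ↦ (1 - b i * b j)⁻¹ with hCdef
  have hd := hC.det_pos
  have h := det_add_smul_vecMulVec hd.ne'.isUnit 1 (-1)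
  have hE : C + (-1 : ℝ) • vecMulVec 1 1 = diagonal b * C * diagonal b := by
    ext i j
    have : 1 - b i * b j ≠ 0 := by
      have : |b i * b j| < 1 := by
        rw [abs_mul]
        exact mul_lt_one_of_nonneg_of_lt_one_left (abs_nonneg _) (hb i) (hb j).le
      linarith [le_abs_self (b i * b j)]
    simp [hCdef]
    field_simp
    ring
  rw [hE, det_mul, det_mul, det_diagonal, mul_right_comm, mul_comm] at h
  have h' := mul_left_cancel₀ hd.ne' h
  rw [Finset.prod_pow, sq, h']
  ring

theorem Matrix.continuousAt_dotProduct_inv_mulVec {n : Type*} [Fintype n] [DecidableEq n]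
    {X : Type*} [TopologicalSpace X] {M : X → Matrix n n ℝ} {t : X}
    (hM : ContinuousAt M t) (ht : (M t).det ≠ 0) (u : n → ℝ) :
    ContinuousAt (fun s ↦ u ⬝ᵥ (M s)⁻¹ *ᵥ u) t := by
  have hdet : ContinuousAt (fun s ↦ (M s).det) t := (continuous_id.matrix_det).continuousAt.comp hM
  have hadj : ContinuousAt (fun s ↦ u ⬝ᵥ (M s).adjugate *ᵥ u) t := by
    have : Continuous fun N : Matrix n n ℝ ↦ u ⬝ᵥ N.adjugate *ᵥ u := by fun_prop
    exact this.continuousAt.comp hM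
  simpa [inv_def, smul_mulVec, Pi.mul_def] using (hdet.inv₀ ht).mul hadj

theorem one_lt_abs_mul {x y : ℝ} (hx : 1 < |x|) (hy : 1 < |y|) : 1 < |x * y| := by
  rw [abs_mul]
  exact one_lt_mul_of_lt_of_le hx hy.le

theorem prod_sq_lt_of_riccati {n : Type*} [Fintype n] [DecidableEq n] [Nonempty n] {a : n → ℝ}
    {P Q : Matrix n n ℝ} (hP : P.PosDef) (hQ : Q.PosDef) (u : n → ℝ) {h x : ℝ} (hx : 0 ≤ x)
    (hE : P = diagonal a * (P - (h ^ 2 / (1 + h ^ 2 * x)) • vecMulVec u u) * (diagonal a)ᴴ + Q)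
    (hu : u ⬝ᵥ P⁻¹ *ᵥ u ≤ x) : ∏ j, a j ^ 2 < 1 + h ^ 2 * x := by
  have hden : 0 < 1 + h ^ 2 * x := by positivity
  set c := h ^ 2 / (1 + h ^ 2 * x) with hc
  have hc0 : 0 ≤ c := by positivity
  have hcx : 1 - c * x = (1 + h ^ 2 * x)⁻¹ := by
    rw [hc]
    field_simp
    ring
  have hcu : c * (u ⬝ᵥ P⁻¹ *ᵥ u) ≤ c * x := by gcongr
  have hinv := inv_pos.mpr hden
  have hN := (hP.sub_smul_vecMulVec_posSemidef u hc0 (by linarith)).mul_mul_conjTranspose_same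
    (diagonal a)
  have hlt := hN.det_lt_det_add_posDef hQ
  have hd := hP.det_pos
  rw [← hE, sub_eq_add_neg, ← neg_smul, det_mul, det_mul, det_conjTranspose, star_trivial,
    det_diagonal, det_add_smul_vecMulVec hd.ne'.isUnit] at hlt
  have hprod : 0 ≤ ∏ j, a j ^ 2 := Finset.prod_nonneg fun _ _ ↦ sq_nonneg _
  have hlt' : (∏ j, a j ^ 2) * (1 + -c * (u ⬝ᵥ P⁻¹ *ᵥ u)) * P.det < 1 * P.det := by
    rw [Finset.prod_pow]
    linarith
  have h1 := lt_of_mul_lt_mul_right hlt' hd.le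
  have h2 : (∏ j, a j ^ 2) * (1 + h ^ 2 * x)⁻¹ < 1 :=
    lt_of_le_of_lt (mul_le_mul_of_nonneg_left (by linarith) hprod) h1
  rwa [← div_eq_mul_inv, div_lt_one hden] at h2

theorem exists_riccati_of_prod_sq_lt {k : ℕ} {a : Fin k → ℝ} (ha : ∀ j, 1 < |a j|)
    (hdist : Function.Injective a) {Q : Matrix (Fin k) (Fin k) ℝ} (hQ : Q.IsHermitian)
    {c p : ℝ} (hc : 0 < c) (hlt : 1 - ∏ j, ((a j)⁻¹) ^ 2 < c * p) :
    ∃ (P : Matrix (Fin k) (Fin k) ℝ) (u : Fin k → ℝ), P.PosDef ∧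
      (∀ i j, P i j = a i * P i j * a j + Q i j - c * (a i * u i * u j * a j)) ∧
      u ⬝ᵥ P⁻¹ *ᵥ u ≤ p := by
  have hb : ∀ i, |(a i)⁻¹| < 1 := fun i ↦ by
    rw [abs_inv]
    exact inv_lt_one_of_one_lt₀ (ha i)
  have hinj : Function.Injective fun i ↦ (a i)⁻¹ := inv_injective.comp hdist
  have hC := posDef_one_sub_mul_inv hb hinj
  have hone := one_dotProduct_inv_mulVec_one hb hinj
  set C : Matrix (Fin k) (Fin k) ℝ := Matrix.of fun i j ↦ (1 - (a i)⁻¹ * (a j)⁻¹)⁻¹ with hCdef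
  set R : Matrix (Fin k) (Fin k) ℝ := Matrix.of fun i j ↦ Q i j / (a i * a j - 1) with hRdef
  have hR : R.IsHermitian := by
    ext i j
    have := hQ.apply i j
    rw [star_trivial] at this
    simp [hRdef, this, mul_comm]
  have hf : ContinuousAt (fun s : ℝ ↦ (1 : Fin k → ℝ) ⬝ᵥ (C - s • R)⁻¹ *ᵥ 1) 0 :=
    continuousAt_dotProduct_inv_mulVec (by fun_prop) (by simpa using hC.det_pos.ne') 1
  have hev := hf.eventually_lt_const (u := c * p) (by simpa [hone] using hlt)
  obtain ⟨s, ⟨hsM, hsf⟩, hs⟩ := (((hC.eventually_sub_smul hR).and hev).filter_mono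
    nhdsWithin_le_nhds |>.and (self_mem_nhdsWithin (s := Set.Ioi (0 : ℝ)))).exists
  replace hs : 0 < s := hs
  have hτ : √(c * s)⁻¹ * √(c * s)⁻¹ = (c * s)⁻¹ := Real.mul_self_sqrt (by positivity)
  refine ⟨s⁻¹ • (C - s • R), √(c * s)⁻¹ • 1, hsM.smul (inv_pos.mpr hs), fun i j ↦ ?_, ?_⟩
  · have hij := one_lt_abs_mul (ha i) (ha j)
    have hne : a i * a j - 1 ≠ 0 := fun h0 ↦ by
      rw [sub_eq_zero.mp h0, abs_one] at hij
      exact lt_irrefl _ hij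
    have ha0 : ∀ i, a i ≠ 0 := fun i h0 ↦ by
      have := ha i
      rw [h0, abs_zero] at this
      linarith
    have hi := ha0 i
    have hj := ha0 j
    have hCij : C i j = a i * a j / (a i * a j - 1) := by
      have : 1 - (a i)⁻¹ * (a j)⁻¹ = (a i * a j - 1) / (a i * a j) := by
        field_simp
      rw [hCdef, of_apply, this, inv_div]
    have hcτ : c * (a i * √(c * s)⁻¹ * √(c * s)⁻¹ * a j) = a i * a j * s⁻¹ := by
      calc _ = c * (a i * a j * (√(c * s)⁻¹ * √(c * s)⁻¹)) := by ring
        _ = a i * a j * s⁻¹ := by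
          rw [hτ]
          field_simp
    simp only [Matrix.smul_apply, Matrix.sub_apply, Pi.smul_apply, Pi.one_apply, smul_eq_mul,
      mul_one, hcτ, hCij]
    rw [hRdef, of_apply]
    field_simp
    ring
  · have hu : IsUnit (C - s • R).det := hsM.det_pos.ne'.isUnit
    have hPinv : (s⁻¹ • (C - s • R))⁻¹ = s • (C - s • R)⁻¹ := by
      refine inv_eq_right_inv ?_
      rw [smul_mul_smul_comm, mul_nonsing_inv _ hu, inv_mul_cancel₀ hs.ne', one_smul]
    rw [hPinv, mulVec_smul, smul_mulVec, smul_dotProduct, dotProduct_smul, dotProduct_smul,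
      smul_eq_mul, smul_eq_mul, smul_eq_mul, ← mul_assoc, hτ, ← mul_assoc]
    have hcs : (c * s)⁻¹ * s = c⁻¹ := by field_simp
    rw [hcs, inv_mul_le_iff₀ hc]
    exact hsf.le

theorem Matrix.mul_mul_transpose_apply_zero {n : Type*} [Fintype n] (N : Matrix n n ℝ)
    (Γ : Matrix (Fin 1) n ℝ) : (Γ * N * Γᵀ) 0 0 = Γ 0 ⬝ᵥ N *ᵥ Γ 0 := by
  rw [Matrix.mul_assoc]
  rfl

/-- Scalar-channel case: for `A = diag a` with `|aⱼ| > 1` distinct, `Q ≻ 0`, channel gain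
`h ≠ 0` and power `p > 0`, a power-feasible stabilizing DARE solution exists iff
`∏ aⱼ² < 1 + h²p`. -/
theorem stmt5 {k : ℕ} (a : Fin k → ℝ) (ha : ∀ j, 1 < |a j|)
    (hdist : Function.Injective a)
    (Q : Matrix (Fin k) (Fin k) ℝ) (hQ : Q.PosDef) (h p : ℝ) (hh : h ≠ 0) (hp : 0 < p) :
    (∃ (P : Matrix (Fin k) (Fin k) ℝ) (Γ : Matrix (Fin 1) (Fin k) ℝ) (x : ℝ),
      P.PosDef ∧ 0 ≤ x ∧ x ≤ p ∧
      P = diagonal a * P * (diagonal a)ᵀ + Q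
        - (h ^ 2 / (1 + h ^ 2 * x)) • (diagonal a * Γᵀ * Γ * (diagonal a)ᵀ) ∧
      (Γ * P⁻¹ * Γᵀ) 0 0 ≤ x) ↔
    (∏ j, (a j) ^ 2) < 1 + h ^ 2 * p := by
  constructor
  · rintro ⟨P, Γ, x, hP, hx0, hxp, hE, hΓ⟩
    have hle : 1 + h ^ 2 * x ≤ 1 + h ^ 2 * p := by gcongr
    rcases isEmpty_or_nonempty (Fin k) with hk | hk
    · rw [Finset.univ_eq_empty, Finset.prod_empty]
      have : 0 < h ^ 2 * p := by positivity
      linarith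
    · refine (prod_sq_lt_of_riccati hP hQ (Γ 0) hx0 ?_ ?_).trans_le hle
      · have hv : vecMulVec (Γ 0) (Γ 0) = Γᵀ * Γ := by
          ext i j
          simp [vecMulVec_apply, Matrix.mul_apply]
        rw [conjTranspose_eq_transpose_of_trivial, hv, Matrix.mul_sub, Matrix.sub_mul,
          Matrix.mul_smul, Matrix.smul_mul, ← Matrix.mul_assoc (diagonal a) Γᵀ Γ, sub_add_eq_add_sub]
        exact hE
      · rwa [← mul_mul_transpose_apply_zero]
  · intro hlt
    have hden : 0 < 1 + h ^ 2 * p := by positivity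
    have hprod : 0 < ∏ j, a j ^ 2 := Finset.prod_pos fun j _ ↦ by
      have := ha j
      exact sq_pos_of_pos (a := |a j|) (by linarith) |>.trans_eq (sq_abs _)
    have hcp : 1 - ∏ j, ((a j)⁻¹) ^ 2 < h ^ 2 / (1 + h ^ 2 * p) * p := by
      have h1 : h ^ 2 / (1 + h ^ 2 * p) * p = 1 - (1 + h ^ 2 * p)⁻¹ := by
        field_simp
        ring
      have h2 := inv_strictAnti₀ hprod hlt
      simp only [inv_pow, Finset.prod_inv_distrib]
      linarith
    obtain ⟨P, u, hP, hE, hu⟩ := exists_riccati_of_prod_sq_lt ha hdist hQ.1 (by positivity) hcp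
    refine ⟨P, Matrix.of fun _ ↦ u, p, hP, hp.le, le_rfl, ?_, ?_⟩
    · ext i j
      rw [diagonal_transpose, Matrix.sub_apply, Matrix.add_apply, Matrix.smul_apply,
        mul_diagonal, mul_diagonal, diagonal_mul, Matrix.mul_apply]
      simpa [diagonal_mul] using hE i j
    · rwa [mul_mul_transpose_apply_zero]
end
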